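/- arXiv:0704.2467 — 16 statements merged into one kernel-verified Lean document; each statement's English description precedes it below -/
import Mathlib

section
/- Let α0, α1, α2 be complex parameters with α0 − α1 + 2α2 = 0, and define the Hamiltonians H1(q,p,t) = (q²p² + qp² − (α0+α1)qp − α0·p)/t and H2(q,p,t) = (q²p² + (1−2α2)qp + t·p)/t. Let I ⊆ ℝ (or a domain in ℂ) be an interval with 0 ∉ I, and let (q,p) : I → ℂ² be a differentiable solution of the Hamiltonian system dq/dt = ∂H1/∂p = (2q²p + 2qp − (α0+α1)q − α0)/t, dp/dt = −∂H1/∂q = −(2qp² + p² − (α0+α1)p)/t, such that p(t) ≠ 0 for all t ∈ I. Then the transformed pair Q(t) = t/p(t), P(t) = (q(t)p(t) − α0)p(t)/t solves the Hamiltonian system of H2: dQ/dt = ∂H2/∂p(Q,P,t) = (2Q²P + (1−2α2)Q + t)/t, dP/dt = −∂H2/∂q(Q,P,t) = −(2QP² + (1−2α2)P)/t. -/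
/-- A solution of the Hamiltonian system of
`H1(q,p,t) = (q²p² + qp² − (α0+α1)qp − α0 p)/t` on a set `I ⊆ ℝ`. -/
def IsSolH1 (a0 a1 : ℂ) (I : Set ℝ) (q p : ℝ → ℂ) : Prop :=
  ∀ t ∈ I,
    HasDerivAt q ((2 * q t ^ 2 * p t + 2 * q t * p t - (a0 + a1) * q t - a0) / t) t ∧
    HasDerivAt p (-(2 * q t * p t ^ 2 + p t ^ 2 - (a0 + a1) * p t) / t) t

/-- A solution of the Hamiltonian system of
`H2(q,p,t) = (q²p² + (1−2α2)qp + tp)/t` on a set `I ⊆ ℝ`. -/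
def IsSolH2 (a2 : ℂ) (I : Set ℝ) (Q P : ℝ → ℂ) : Prop :=
  ∀ t ∈ I,
    HasDerivAt Q ((2 * Q t ^ 2 * P t + (1 - 2 * a2) * Q t + t) / t) t ∧
    HasDerivAt P (-(2 * Q t * P t ^ 2 + (1 - 2 * a2) * P t) / t) t

/-- Proposition 1 (part `tr₁`): the birational symplectic transformation
`tr₁(q,p) = (t/p, (qp−α0)p/t)` maps solutions of the `H1` system to
solutions of the `H2` system, where `α0 − α1 + 2α2 = 0`. -/
theorem tr1_maps_H1_to_H2 (a0 a1 a2 : ℂ) (hpar : a0 - a1 + 2 * a2 = 0)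
    (I : Set ℝ) (hI : (0 : ℝ) ∉ I) (q p : ℝ → ℂ)
    (hsol : IsSolH1 a0 a1 I q p) (hp : ∀ t ∈ I, p t ≠ 0)
    (Q P : ℝ → ℂ)
    (hQ : ∀ t : ℝ, Q t = (t : ℂ) / p t)
    (hP : ∀ t : ℝ, P t = (q t * p t - a0) * p t / t) :
    IsSolH2 a2 I Q P := by
  obtain rfl : a1 = a0 + 2 * a2 := by linear_combination -hpar
  obtain rfl : Q = fun s : ℝ => (s : ℂ) / p s := funext hQ
  obtain rfl : P = fun s : ℝ => (q s * p s - a0) * p s / s := funext hP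
  intro t ht
  obtain ⟨hq', hp'⟩ := hsol t ht
  have hpt : p t ≠ 0 := hp t ht
  have ht0 : (t : ℂ) ≠ 0 := by
    rintro h
    exact hI (Complex.ofReal_eq_zero.mp h ▸ ht)
  have hid : HasDerivAt (fun s : ℝ => (s : ℂ)) 1 t := (hasDerivAt_id t).ofReal_comp
  constructor
  · refine (hid.fun_div hp' hpt).congr_deriv ?_
    field_simp
    ring
  · refine ((((hq'.fun_mul hp').sub_const a0).fun_mul hp').fun_div hid ht0).congr_deriv ?_
    field_simp
    ring
end

section
/- Let α0, α1, α2 be complex parameters with α0 − α1 + 2α2 = 0, and define the Hamiltonians H1(q,p,t) = (q²p² + qp² − (α0+α1)qp − α0·p)/t and H4(q,p,t) = (q²p² − t·q²p − (1−α0−α1)qp − α0·t·q)/t. Let I be an interval with 0 ∉ I and let (q,p) : I → ℂ² be a differentiable solution of the Hamiltonian system of H1 (dq/dt = (2q²p + 2qp − (α0+α1)q − α0)/t, dp/dt = −(2qp² + p² − (α0+α1)p)/t). Then Q(t) = p(t)/t, P(t) = −t·q(t) solves the Hamiltonian system of H4: dQ/dt = ∂H4/∂p(Q,P,t) = (2Q²P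 − tQ² − (1−α0−α1)Q)/t and dP/dt = −∂H4/∂q(Q,P,t) = (−2QP² + 2tQP + (1−α0−α1)P + α0·t)/t. -/
/-- A solution of the Hamiltonian system of
`H4(q,p,t) = (q²p² − tq²p − (1−α0−α1)qp − α0·t·q)/t` on a set `I ⊆ ℝ`. -/
def IsSolH4 (a0 a1 : ℂ) (I : Set ℝ) (Q P : ℝ → ℂ) : Prop :=
  ∀ t ∈ I,
    HasDerivAt Q ((2 * Q t ^ 2 * P t - t * Q t ^ 2 - (1 - a0 - a1) * Q t) / t) t ∧
    HasDerivAt P ((-2 * Q t * P t ^ 2 + 2 * t * Q t * P t + (1 - a0 - a1) * P t + a0 * t) / t) t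

/-- Proposition 1 (part `tr₃`): the birational symplectic transformation
`tr₃(q,p) = (p/t, −tq)` maps solutions of the `H1` system to solutions of the
`H4` system, where `α0 − α1 + 2α2 = 0`. -/
theorem tr3_maps_H1_to_H4 (a0 a1 a2 : ℂ) (hpar : a0 - a1 + 2 * a2 = 0)
    (I : Set ℝ) (hI : (0 : ℝ) ∉ I) (q p : ℝ → ℂ)
    (hsol : IsSolH1 a0 a1 I q p)
    (Q P : ℝ → ℂ)
    (hQ : ∀ t : ℝ, Q t = p t / t)
    (hP : ∀ t : ℝ, P t = -(t : ℂ) * q t) :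
    IsSolH4 a0 a1 I Q P := by
  intro t ht
  obtain ⟨hq, hp⟩ := hsol t ht
  have ht0 : (t : ℂ) ≠ 0 := by
    rintro h
    exact hI (Complex.ofReal_eq_zero.mp h ▸ ht)
  have hid : HasDerivAt (fun s : ℝ => (s : ℂ)) 1 t := Complex.ofRealCLM.hasDerivAt
  obtain rfl : Q = fun s : ℝ => p s / s := funext hQ
  obtain rfl : P = fun s : ℝ => -(s : ℂ) * q s := funext hP
  constructor
  · refine (hp.fun_div hid ht0).congr_deriv ?_
    field_simp
    ring
  · refine (hid.fun_neg.fun_mul hq).congr_deriv ?_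
    field_simp
    ring
end

section
/- Let (x,y,z,w,q,p) : I → ℂ⁶ be a differentiable solution of the system of type D5^(1) with parameters (α0,α1,α2,α3,α4,α5), and assume x(t) ≠ 0 for all t ∈ I. Then (x, y − α0/x, z, w, q, p) is a solution of the same system of type D5^(1) with parameters (−α0, α1, α2+α0, α3, α4, α5) (which again satisfy the normalization condition). -/
/-- A solution of the system of type `D5^(1)` (equation (4) of the paper) with
parameters `(a0,…,a5)` on a set `I ⊆ ℝ`. -/
def IsSolD5 (a0 a1 a2 a3 a4 a5 : ℂ) (I : Set ℝ) (x y z w q p : ℝ → ℂ) : Prop :=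
  ∀ t ∈ I,
    HasDerivAt x ((2 * x t ^ 2 * y t + 2 * x t * y t - (a0 + a1) * x t - a0) / t) t ∧
    HasDerivAt y (-(2 * x t * y t ^ 2 + y t ^ 2 - (a0 + a1) * y t + 2 * z t) / t) t ∧
    HasDerivAt z ((2 * z t ^ 2 * w t + (a0 + a1 + 2 * a2) * z t + t - 2 * p t) / t) t ∧
    HasDerivAt w (-(2 * z t * w t ^ 2 + (a0 + a1 + 2 * a2) * w t + 1 + 2 * x t) / t) t ∧
    HasDerivAt q ((2 * q t ^ 2 * p t - t * q t ^ 2 - (1 - a4 - a5) * q t - 2 * w t) / t) t ∧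
    HasDerivAt p ((-2 * q t * p t ^ 2 + 2 * t * q t * p t + (1 - a4 - a5) * p t + a4 * t) / t) t

/-- Theorem 2.1, transformation `s₀`: if `(x,y,z,w,q,p)` solves the `D5^(1)`
system with parameters `(α0,…,α5)` and `x ≠ 0` on `I`, then
`(x, y − α0/x, z, w, q, p)` solves it with parameters
`(−α0, α1, α2+α0, α3, α4, α5)`. -/
theorem D5_backlund_s0 (a0 a1 a2 a3 a4 a5 : ℂ)
    (hpar : a0 + a1 + 2 * a2 + 2 * a3 + a4 + a5 = 1)
    (I : Set ℝ) (hI : (0 : ℝ) ∉ I) (x y z w q p : ℝ → ℂ)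
    (hsol : IsSolD5 a0 a1 a2 a3 a4 a5 I x y z w q p)
    (hx : ∀ t ∈ I, x t ≠ 0) :
    IsSolD5 (-a0) a1 (a2 + a0) a3 a4 a5 I
      x (fun t => y t - a0 / x t) z w q p := by
  intro t ht
  obtain ⟨hx', hy', hz', hw', hq', hp'⟩ := hsol t ht
  have hxt : x t ≠ 0 := hx t ht
  have htC : (t : ℂ) ≠ 0 := Complex.ofReal_ne_zero.2 fun h => hI (h ▸ ht)
  refine ⟨?_, ?_, ?_, ?_, hq', hp'⟩
  · refine hx'.congr_deriv ?_
    field_simp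
    ring
  · refine (hy'.fun_sub ((hasDerivAt_const t a0).fun_div hx' hxt)).congr_deriv ?_
    field_simp
    ring
  · refine hz'.congr_deriv ?_
    ring
  · refine hw'.congr_deriv ?_
    ring
end

section
/- Let (x,y,z,w,q,p) : I → ℂ⁶ be a differentiable solution of the system of type D5^(1) with parameters (α0,α1,α2,α3,α4,α5), and assume y(t)w(t) + 1 ≠ 0 for all t ∈ I. Then (x + α2·w/(yw+1), y, z + α2·y/(yw+1), w, q, p) is a solution of the same system of type D5^(1) with parameters (α0+α2, α1+α2, −α2, α3+α2, α4, α5). -/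
/-- Theorem 2.1, transformation `s₂`: if `(x,y,z,w,q,p)` solves the `D5^(1)`
system with parameters `(α0,…,α5)` and `yw + 1 ≠ 0` on `I`, then
`(x + α2 w/(yw+1), y, z + α2 y/(yw+1), w, q, p)` solves it with parameters
`(α0+α2, α1+α2, −α2, α3+α2, α4, α5)`. -/
theorem D5_backlund_s2 (a0 a1 a2 a3 a4 a5 : ℂ)
    (hpar : a0 + a1 + 2 * a2 + 2 * a3 + a4 + a5 = 1)
    (I : Set ℝ) (hI : (0 : ℝ) ∉ I) (x y z w q p : ℝ → ℂ)
    (hsol : IsSolD5 a0 a1 a2 a3 a4 a5 I x y z w q p)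
    (hyw : ∀ t ∈ I, y t * w t + 1 ≠ 0) :
    IsSolD5 (a0 + a2) (a1 + a2) (-a2) (a3 + a2) a4 a5 I
      (fun t => x t + a2 * w t / (y t * w t + 1)) y
      (fun t => z t + a2 * y t / (y t * w t + 1)) w q p := by
  intro t ht
  obtain ⟨hx, hy, hz, hw, hq, hp⟩ := hsol t ht
  have hd := hyw t ht
  have ht0 : (t : ℂ) ≠ 0 := by
    rintro h
    exact hI (Complex.ofReal_eq_zero.mp h ▸ ht)
  have hden := (hy.fun_mul hw).add_const 1
  have hx' := hx.fun_add ((hw.const_mul a2).fun_div hden hd)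
  have hz' := hz.fun_add ((hy.const_mul a2).fun_div hden hd)
  refine ⟨hx'.congr_deriv ?_, hy.congr_deriv ?_, hz'.congr_deriv ?_, hw.congr_deriv ?_, hq, hp⟩
  all_goals
    -- `field_simp` may order the product in the denominator either way
    have hd' : w t * y t + 1 ≠ 0 := mul_comm (y t) (w t) ▸ hd
    field_simp
    ring
end

section
/- Let (x,y,z,w,q,p) : I → ℂ⁶ be a differentiable solution of the system of type D5^(1) with parameters (α0,α1,α2,α3,α4,α5), and assume z(t)q(t) − 1 ≠ 0 for all t ∈ I. Then (x, y, z, w − α3·q/(zq−1), q, p − α3·z/(zq−1)) is a solution of the same system of type D5^(1) with parameters (α0, α1, α2+α3, −α3, α4+α3, α5+α3). -/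
/-- Theorem 2.1, transformation `s₃`: if `(x,y,z,w,q,p)` solves the `D5^(1)`
system with parameters `(α0,…,α5)` and `zq − 1 ≠ 0` on `I`, then
`(x, y, z, w − α3 q/(zq−1), q, p − α3 z/(zq−1))` solves it with parameters
`(α0, α1, α2+α3, −α3, α4+α3, α5+α3)`. -/
theorem D5_backlund_s3 (a0 a1 a2 a3 a4 a5 : ℂ)
    (hpar : a0 + a1 + 2 * a2 + 2 * a3 + a4 + a5 = 1)
    (I : Set ℝ) (hI : (0 : ℝ) ∉ I) (x y z w q p : ℝ → ℂ)
    (hsol : IsSolD5 a0 a1 a2 a3 a4 a5 I x y z w q p)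
    (hzq : ∀ t ∈ I, z t * q t - 1 ≠ 0) :
    IsSolD5 a0 a1 (a2 + a3) (-a3) (a4 + a3) (a5 + a3) I
      x y z (fun t => w t - a3 * q t / (z t * q t - 1)) q
      (fun t => p t - a3 * z t / (z t * q t - 1)) := by
  intro t ht
  obtain ⟨hx, hy, hz, hw, hq, hp⟩ := hsol t ht
  have hD := hzq t ht
  have hD' : q t * z t - 1 ≠ 0 := by rwa [mul_comm]
  have ht0 : (t : ℂ) ≠ 0 := fun h => hI (Complex.ofReal_eq_zero.mp h ▸ ht)
  have hDeriv : HasDerivAt (fun s => z s * q s - 1) _ t := (hz.mul hq).sub_const 1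
  obtain rfl : a5 = 1 - a0 - a1 - 2 * a2 - 2 * a3 - a4 := by linear_combination hpar
  refine ⟨hx, hy, hz.congr_deriv ?_, (hw.sub ((hq.const_mul a3).div hDeriv hD)).congr_deriv ?_,
    hq.congr_deriv ?_, (hp.sub ((hz.const_mul a3).div hDeriv hD)).congr_deriv ?_⟩
  all_goals
    beta_reduce
    field_simp
    ring
end

section
/- Let (x,y,z,w,q,p) : I → ℂ⁶ be a differentiable solution of the system of type D5^(1) with parameters (α0,α1,α2,α3,α4,α5), and assume p(t) ≠ 0 for all t ∈ I. Then (x, y, z, w, q + α4/p, p) is a solution of the same system of type D5^(1) with parameters (α0, α1, α2, α3+α4, −α4, α5). -/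
/-- Theorem 2.1, transformation `s₄`: if `(x,y,z,w,q,p)` solves the `D5^(1)`
system with parameters `(α0,…,α5)` and `p ≠ 0` on `I`, then
`(x, y, z, w, q + α4/p, p)` solves it with parameters
`(α0, α1, α2, α3+α4, −α4, α5)`. -/
theorem D5_backlund_s4 (a0 a1 a2 a3 a4 a5 : ℂ)
    (hpar : a0 + a1 + 2 * a2 + 2 * a3 + a4 + a5 = 1)
    (I : Set ℝ) (hI : (0 : ℝ) ∉ I) (x y z w q p : ℝ → ℂ)
    (hsol : IsSolD5 a0 a1 a2 a3 a4 a5 I x y z w q p)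
    (hp : ∀ t ∈ I, p t ≠ 0) :
    IsSolD5 a0 a1 a2 (a3 + a4) (-a4) a5 I
      x y z w (fun t => q t + a4 / p t) p := by
  intro t ht
  obtain ⟨hx, hy, hz, hw, hq, hp'⟩ := hsol t ht
  have hpt := hp t ht
  have ht0 : (t : ℂ) ≠ 0 := Complex.ofReal_ne_zero.mpr fun h => hI (h ▸ ht)
  refine ⟨hx, hy, hz, hw, ?_, ?_⟩
  · refine (hq.fun_add ((hasDerivAt_const t a4).fun_div hp' hpt)).congr_deriv ?_
    field_simp
    ring
  · refine hp'.congr_deriv ?_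
    field_simp
    ring
end

section
/- Let (x,y,z,w,q,p) : I → ℂ⁶ be a differentiable solution of the system of type D5^(1) with parameters (α0,α1,α2,α3,α4,α5), and assume p(t) − t ≠ 0 for all t ∈ I. Then (x, y, z, w, q + α5/(p−t), p) is a solution of the same system of type D5^(1) with parameters (α0, α1, α2, α3+α5, α4, −α5). -/
/-- Theorem 2.1, transformation `s₅`: if `(x,y,z,w,q,p)` solves the `D5^(1)`
system with parameters `(α0,…,α5)` and `p − t ≠ 0` on `I`, then
`(x, y, z, w, q + α5/(p−t), p)` solves it with parameters
`(α0, α1, α2, α3+α5, α4, −α5)`. -/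
theorem D5_backlund_s5 (a0 a1 a2 a3 a4 a5 : ℂ)
    (hpar : a0 + a1 + 2 * a2 + 2 * a3 + a4 + a5 = 1)
    (I : Set ℝ) (hI : (0 : ℝ) ∉ I) (x y z w q p : ℝ → ℂ)
    (hsol : IsSolD5 a0 a1 a2 a3 a4 a5 I x y z w q p)
    (hpt : ∀ t ∈ I, p t - (t : ℂ) ≠ 0) :
    IsSolD5 a0 a1 a2 (a3 + a5) a4 (-a5) I
      x y z w (fun t => q t + a5 / (p t - (t : ℂ))) p := by
  intro t ht
  obtain ⟨hx, hy, hz, hw, hq, hp⟩ := hsol t ht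
  have ht0 : (t : ℂ) ≠ 0 := by
    rw [Complex.ofReal_ne_zero]
    rintro rfl
    exact hI ht
  have hu := hpt t ht
  refine ⟨hx, hy, hz, hw, ?_, ?_⟩
  · have hid : HasDerivAt (fun s : ℝ => (s : ℂ)) 1 t := Complex.ofRealCLM.hasDerivAt
    refine (hq.add ((hasDerivAt_const t a5).div (hp.sub hid) hu)).congr_deriv ?_
    simp only [Pi.sub_apply]
    field_simp
    ring
  · refine hp.congr_deriv ?_
    field_simp
    ring
end

section
/- Let (x,y,z,w,q,p) : I → ℂ⁶ be a differentiable solution of the system of type D5^(1) with parameters (α0,α1,α2,α3,α4,α5) on an interval I with 0 ∉ I. Define new functions on the reflected interval −I by X(s) = (p(−s) − (−s))/(−s), Y(s) = −(−s)·q(−s), Z(s) = −(−s)·w(−s), W(s) = z(−s)/(−s), Q(s) = y(−s)/(−s), P(s) = −(−s)·(x(−s) + 1). Then (X,Y,Z,W,Q,P) is a solution of the system of type D5^(1) on −I with the reversed parameters (α5, α4, α3, α2, α1, α0). -/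
/-- The chain rule for a reflected argument. -/
theorem HasDerivAt.comp_neg_real {f : ℝ → ℂ} {f' : ℂ} {s : ℝ} (hf : HasDerivAt f f' (-s)) :
    HasDerivAt (fun u => f (-u)) (-f') s :=
  (hf.scomp s (hasDerivAt_neg s)).congr_deriv (by simp)

/-- Theorem 2.1, diagram rotation `π₃`: if `(x,y,z,w,q,p)` solves the `D5^(1)`
system with parameters `(α0,…,α5)` on `I` (with `0 ∉ I`), then the functions
`X(s) = (p(−s) − (−s))/(−s)`, `Y(s) = −(−s)q(−s)`, `Z(s) = −(−s)w(−s)`,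
`W(s) = z(−s)/(−s)`, `Q(s) = y(−s)/(−s)`, `P(s) = −(−s)(x(−s)+1)` solve the
`D5^(1)` system on `−I` with the reversed parameters `(α5,α4,α3,α2,α1,α0)`. -/
theorem D5_backlund_pi3 (a0 a1 a2 a3 a4 a5 : ℂ)
    (hpar : a0 + a1 + 2 * a2 + 2 * a3 + a4 + a5 = 1)
    (I : Set ℝ) (hI : (0 : ℝ) ∉ I) (x y z w q p : ℝ → ℂ)
    (hsol : IsSolD5 a0 a1 a2 a3 a4 a5 I x y z w q p) :
    IsSolD5 a5 a4 a3 a2 a1 a0 (-I)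
      (fun s => (p (-s) - (-(s : ℂ))) / (-(s : ℂ)))
      (fun s => -(-(s : ℂ)) * q (-s))
      (fun s => -(-(s : ℂ)) * w (-s))
      (fun s => z (-s) / (-(s : ℂ)))
      (fun s => y (-s) / (-(s : ℂ)))
      (fun s => -(-(s : ℂ)) * (x (-s) + 1)) := by
  intro s hs
  have hs' : -s ∈ I := hs
  have hs0 : (s : ℂ) ≠ 0 := by
    intro h
    rw [Complex.ofReal_eq_zero] at h
    subst h
    exact hI (by simpa using hs')
  have hn0 : -(s : ℂ) ≠ 0 := neg_ne_zero.mpr hs0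
  obtain ⟨hx, hy, hz, hw, hq, hp⟩ := hsol (-s) hs'
  have hid : HasDerivAt (fun u : ℝ => -(u : ℂ)) (-1) s :=
    (HasDerivAt.ofReal_comp (hasDerivAt_id s)).neg
  have ha3 : 2 * a3 = 1 - a0 - a1 - 2 * a2 - a4 - a5 := by linear_combination hpar
  refine ⟨?_, ?_, ?_, ?_, ?_, ?_⟩
  · refine HasDerivAt.congr_deriv ((hp.comp_neg_real.sub hid).div hid hn0) ?_
    simp only [Pi.sub_apply, Complex.ofReal_neg]
    field_simp
    ring
  · refine HasDerivAt.congr_deriv (hid.neg.mul hq.comp_neg_real) ?_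
    simp only [Pi.neg_apply, Complex.ofReal_neg]
    field_simp
    ring
  · refine HasDerivAt.congr_deriv (hid.neg.mul hw.comp_neg_real) ?_
    simp only [Pi.neg_apply, Complex.ofReal_neg]
    rw [ha3]
    field_simp
    ring
  · refine HasDerivAt.congr_deriv (hz.comp_neg_real.div hid hn0) ?_
    simp only [Complex.ofReal_neg]
    rw [ha3]
    field_simp
    ring
  · refine HasDerivAt.congr_deriv (hy.comp_neg_real.div hid hn0) ?_
    simp only [Complex.ofReal_neg]
    field_simp
    ring
  · refine HasDerivAt.congr_deriv (hid.neg.mul (hx.comp_neg_real.add_const 1)) ?_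
    simp only [Pi.neg_apply, Complex.ofReal_neg]
    field_simp
    ring
end

section
/- Let (x,y,z,w,q,p) : I → ℂ⁶ be a differentiable solution of the first system of type B5^(1) with parameters (α0,α1,α2,α3,α4,α5) on an interval I with 0 ∉ I, and assume y(t) ≠ 0 for all t ∈ I. Define on the reflected interval −I the functions X(s) = −x(−s) − 2α0/y(−s) + 1/y(−s)², Y(s) = −y(−s), Z(s) = −z(−s), W(s) = −w(−s), Q(s) = −q(−s), P(s) = −p(−s). Then (X,Y,Z,W,Q,P) is a solution of the same first system of type B5^(1) on −I with parameters (−α0, α1+2α0, α2, α3, α4, α5). -/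
/-- A solution of the first system of type `B5^(1)` (equation (5) of the paper)
with parameters `(a0,…,a5)` on a set `I ⊆ ℝ`. -/
def IsSolB5a (a0 a1 a2 a3 a4 a5 : ℂ) (I : Set ℝ) (x y z w q p : ℝ → ℂ) : Prop :=
  ∀ t ∈ I,
    HasDerivAt x ((2 * x t ^ 2 * y t + 2 * a0 * x t) / t -
      (4 * x t * y t * z t - 2 * a1 * z t) / t) t ∧
    HasDerivAt y (-(2 * x t * y t ^ 2 + 2 * a0 * y t - 1) / t + 2 * y t ^ 2 * z t / t) t ∧
    HasDerivAt z ((2 * z t ^ 2 * w t + 2 * (a0 + a1 + a2) * z t + t) / t - 2 * p t / t) t ∧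
    HasDerivAt w (-(2 * z t * w t ^ 2 + 2 * (a0 + a1 + a2) * w t + 1) / t +
      2 * (x t * y t - a1) * y t / t) t ∧
    HasDerivAt q ((2 * q t ^ 2 * p t - t * q t ^ 2 - 2 * (a0 + a1 + a2 + a3) * q t) / t -
      2 * w t / t) t ∧
    HasDerivAt p ((-2 * q t * p t ^ 2 + 2 * t * q t * p t +
      2 * (a0 + a1 + a2 + a3) * p t + a4 * t) / t) t

/-- Theorem 3.1, transformation `s₀`: if `(x,y,z,w,q,p)` solves the first
`B5^(1)` system with parameters `(α0,…,α5)` on `I` with `y ≠ 0`, then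
`X(s) = −x(−s) − 2α0/y(−s) + 1/y(−s)²`, `Y(s) = −y(−s)`, `Z(s) = −z(−s)`,
`W(s) = −w(−s)`, `Q(s) = −q(−s)`, `P(s) = −p(−s)` solve it on `−I` with
parameters `(−α0, α1+2α0, α2, α3, α4, α5)`. -/
theorem B5a_backlund_s0 (a0 a1 a2 a3 a4 a5 : ℂ)
    (hpar : 2 * a0 + 2 * a1 + 2 * a2 + 2 * a3 + a4 + a5 = 1)
    (I : Set ℝ) (hI : (0 : ℝ) ∉ I) (x y z w q p : ℝ → ℂ)
    (hsol : IsSolB5a a0 a1 a2 a3 a4 a5 I x y z w q p)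
    (hy : ∀ t ∈ I, y t ≠ 0) :
    IsSolB5a (-a0) (a1 + 2 * a0) a2 a3 a4 a5 (-I)
      (fun s => -x (-s) - 2 * a0 / y (-s) + 1 / y (-s) ^ 2)
      (fun s => -y (-s)) (fun s => -z (-s)) (fun s => -w (-s))
      (fun s => -q (-s)) (fun s => -p (-s)) := by
  intro s hs
  have hs' : -s ∈ I := hs
  have hs0 : (s : ℂ) ≠ 0 := by
    rw [Complex.ofReal_ne_zero]
    rintro rfl
    exact hI (by simpa using hs')
  have hys := hy _ hs'
  obtain ⟨hx, hy', hz, hw, hq, hp⟩ := hsol _ hs'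
  have reflect := fun {f : ℝ → ℂ} {f' : ℂ} (h : HasDerivAt f f' (-s)) ↦
    h.scomp s (hasDerivAt_neg s)
  have hx₁ := reflect hx
  have hy₁ := reflect hy'
  refine ⟨?_, ?_, ?_, ?_, ?_, ?_⟩
  · have h := (hx₁.neg.sub ((hasDerivAt_const s (2 * a0)).div hy₁ hys)).add
      ((hasDerivAt_const s (1 : ℂ)).div (hy₁.pow 2) (pow_ne_zero 2 hys))
    refine h.congr_deriv ?_
    simp only [Function.comp_apply, Pi.pow_apply, Complex.ofReal_neg, neg_smul, one_smul]
    field_simp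
    ring
  · refine hy₁.neg.congr_deriv ?_
    simp only [Complex.ofReal_neg, neg_smul, one_smul]
    field_simp
    ring
  · refine (reflect hz).neg.congr_deriv ?_
    simp only [Complex.ofReal_neg, neg_smul, one_smul]
    field_simp
    ring
  · refine (reflect hw).neg.congr_deriv ?_
    simp only [Complex.ofReal_neg, neg_smul, one_smul]
    field_simp
    ring
  · refine (reflect hq).neg.congr_deriv ?_
    simp only [Complex.ofReal_neg, neg_smul, one_smul]
    field_simp
    ring
  · refine (reflect hp).neg.congr_deriv ?_
    simp only [Complex.ofReal_neg, neg_smul, one_smul]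
    field_simp
    ring
end

section
/- Let (x,y,z,w,q,p) : I → ℂ⁶ be a differentiable solution of the first system of type B5^(1) with parameters (α0,α1,α2,α3,α4,α5) on an interval I with 0 ∉ I, and assume y(t) + w(t) ≠ 0 for all t ∈ I. Then (x + α2/(y+w), y, z + α2/(y+w), w, q, p) is a solution of the same first system of type B5^(1) with parameters (α0, α1+α2, −α2, α3+α2, α4, α5). -/
/-- Theorem 3.1, transformation `s₂`: if `(x,y,z,w,q,p)` solves the first
`B5^(1)` system with parameters `(α0,…,α5)` and `y + w ≠ 0` on `I`, then
`(x + α2/(y+w), y, z + α2/(y+w), w, q, p)` solves it with parameters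
`(α0, α1+α2, −α2, α3+α2, α4, α5)`. -/
theorem B5a_backlund_s2 (a0 a1 a2 a3 a4 a5 : ℂ)
    (hpar : 2 * a0 + 2 * a1 + 2 * a2 + 2 * a3 + a4 + a5 = 1)
    (I : Set ℝ) (hI : (0 : ℝ) ∉ I) (x y z w q p : ℝ → ℂ)
    (hsol : IsSolB5a a0 a1 a2 a3 a4 a5 I x y z w q p)
    (hyw : ∀ t ∈ I, y t + w t ≠ 0) :
    IsSolB5a a0 (a1 + a2) (-a2) (a3 + a2) a4 a5 I
      (fun t => x t + a2 / (y t + w t)) y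
      (fun t => z t + a2 / (y t + w t)) w q p := by
  intro t ht
  obtain ⟨hx, hy, hz, hw, hq, hp⟩ := hsol t ht
  have hs := hyw t ht
  have ht0 : (t : ℂ) ≠ 0 := by
    intro h
    exact hI (Complex.ofReal_eq_zero.mp h ▸ ht)
  have hu := (hasDerivAt_const t a2).fun_div (hy.fun_add hw) hs
  refine ⟨(hx.add hu).congr_deriv ?_, hy.congr_deriv ?_, (hz.add hu).congr_deriv ?_,
    hw.congr_deriv ?_, hq.congr_deriv ?_, hp.congr_deriv ?_⟩ <;>
  · field_simp
    ring
end

section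
/- Let (x,y,z,w,q,p) : I → ℂ⁶ be a differentiable solution of the system of type D5^(1) with parameters (α0,α1,α2,α3,α4,α5) on an interval I with 0 ∉ I, and assume y(t) ≠ 0 for all t ∈ I. Define the new parameters A0 = (α1−α0)/2, A1 = α0, A2 = α2, A3 = α3, A4 = α4, A5 = α5 and the new functions X = −(xy − α0)y, Y = 1/y, Z = z, W = w, Q = q, P = p. Then 2A0 + 2A1 + 2A2 + 2A3 + A4 + A5 = 1 and (X,Y,Z,W,Q,P) is a solution of the first system of type B5^(1) with parameters (A0,A1,A2,A3,A4,A5). -/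
/-- Theorem 3.3: if `(x,y,z,w,q,p)` solves the `D5^(1)` system with parameters
`(α0,…,α5)` on `I` with `y ≠ 0`, then with the new parameters
`A0 = (α1−α0)/2, A1 = α0, A2 = α2, A3 = α3, A4 = α4, A5 = α5` one has
`2A0 + 2A1 + 2A2 + 2A3 + A4 + A5 = 1`, and
`(X,Y,Z,W,Q,P) = (−(xy−α0)y, 1/y, z, w, q, p)` solves the first `B5^(1)`
system with parameters `(A0,…,A5)`. -/
theorem D5_to_B5a (a0 a1 a2 a3 a4 a5 : ℂ)
    (hpar : a0 + a1 + 2 * a2 + 2 * a3 + a4 + a5 = 1)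
    (I : Set ℝ) (hI : (0 : ℝ) ∉ I) (x y z w q p : ℝ → ℂ)
    (hsol : IsSolD5 a0 a1 a2 a3 a4 a5 I x y z w q p)
    (hy : ∀ t ∈ I, y t ≠ 0) :
    2 * ((a1 - a0) / 2) + 2 * a0 + 2 * a2 + 2 * a3 + a4 + a5 = 1 ∧
    IsSolB5a ((a1 - a0) / 2) a0 a2 a3 a4 a5 I
      (fun t => -(x t * y t - a0) * y t) (fun t => 1 / y t) z w q p := by
  have hsum : a0 + a1 + 2 * a2 + 2 * a3 = 1 - a4 - a5 := by linear_combination hpar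
  refine ⟨by linear_combination hpar, fun t ht => ?_⟩
  obtain ⟨hx, hy', hz, hw, hq, hp⟩ := hsol t ht
  have hyt := hy t ht
  have ht0 : (t : ℂ) ≠ 0 := by
    rintro h
    exact hI (Complex.ofReal_eq_zero.mp h ▸ ht)
  refine ⟨?_, ?_, ?_, ?_, ?_, ?_⟩
  · refine (((hx.mul hy').sub_const a0).neg.mul hy').congr_deriv ?_
    simp only [Pi.mul_apply, Pi.neg_apply]
    field_simp
    ring
  · simp only [one_div]
    refine (hy'.fun_inv hyt).congr_deriv ?_
    field_simp
    ring
  · refine hz.congr_deriv ?_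
    ring
  · refine hw.congr_deriv ?_
    field_simp
    ring
  · refine hq.congr_deriv ?_
    rw [← hsum]
    ring
  · refine hp.congr_deriv ?_
    rw [← hsum]
    ring
end

section
/- Let (x,y,z,w,q,p) : I → ℂ⁶ be a differentiable solution of the second system of type B5^(1) with parameters (α0,α1,α2,α3,α4,α5) on an interval I with 0 ∉ I, and assume q(t) ≠ 0 for all t ∈ I. Define on the reflected interval −I the functions X(s) = x(−s), Y(s) = y(−s), Z(s) = z(−s), W(s) = w(−s), Q(s) = q(−s), P(s) = p(−s) − 2α5/q(−s) + (−s)/q(−s)². Then (X,Y,Z,W,Q,P) is a solution of the same second system of type B5^(1) on −I with parameters (α0, α1, α2, α3, α4+2α5, −α5). -/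
/-- A solution of the second system of type `B5^(1)` (equation (10) of the
paper) with parameters `(a0,…,a5)` on a set `I ⊆ ℝ`. -/
def IsSolB5b (a0 a1 a2 a3 a4 a5 : ℂ) (I : Set ℝ) (x y z w q p : ℝ → ℂ) : Prop :=
  ∀ t ∈ I,
    HasDerivAt x ((2 * x t ^ 2 * y t + 2 * x t * y t - (a0 + a1) * x t - a0) / t) t ∧
    HasDerivAt y (-(2 * x t * y t ^ 2 + y t ^ 2 - (a0 + a1) * y t) / t - 2 * z t / t) t ∧
    HasDerivAt z ((2 * z t ^ 2 * w t + (a0 + a1 + 2 * a2) * z t + t) / t +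
      2 * q t * (q t * p t + a4) / t) t ∧
    HasDerivAt w (-(2 * z t * w t ^ 2 + (a0 + a1 + 2 * a2) * w t + 1) / t - 2 * x t / t) t ∧
    HasDerivAt q ((2 * q t ^ 2 * p t - (2 * a5 - 1) * q t + t) / t + 2 * w t * q t ^ 2 / t) t ∧
    HasDerivAt p ((-2 * q t * p t ^ 2 + (2 * a5 - 1) * p t) / t -
      (4 * w t * q t * p t + 2 * a4 * w t) / t) t

/-- Theorem 3.4, transformation `s₅`: if `(x,y,z,w,q,p)` solves the second
`B5^(1)` system with parameters `(α0,…,α5)` on `I` with `q ≠ 0`, then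
`X(s) = x(−s)`, `Y(s) = y(−s)`, `Z(s) = z(−s)`, `W(s) = w(−s)`,
`Q(s) = q(−s)`, `P(s) = p(−s) − 2α5/q(−s) + (−s)/q(−s)²` solve it on `−I`
with parameters `(α0, α1, α2, α3, α4+2α5, −α5)`. -/
theorem B5b_backlund_s5 (a0 a1 a2 a3 a4 a5 : ℂ)
    (hpar : a0 + a1 + 2 * a2 + 2 * a3 + 2 * a4 + 2 * a5 = 1)
    (I : Set ℝ) (hI : (0 : ℝ) ∉ I) (x y z w q p : ℝ → ℂ)
    (hsol : IsSolB5b a0 a1 a2 a3 a4 a5 I x y z w q p)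
    (hq : ∀ t ∈ I, q t ≠ 0) :
    IsSolB5b a0 a1 a2 a3 (a4 + 2 * a5) (-a5) (-I)
      (fun s => x (-s)) (fun s => y (-s)) (fun s => z (-s)) (fun s => w (-s))
      (fun s => q (-s))
      (fun s => p (-s) - 2 * a5 / q (-s) + (-(s : ℂ)) / q (-s) ^ 2) := by
  intro s hs
  have hs' : -s ∈ I := hs
  have hs0 : (s : ℂ) ≠ 0 := by
    intro h
    have h0 : s = 0 := by exact_mod_cast h
    exact hI (by simpa [h0] using hs')
  have hqs : q (-s) ≠ 0 := hq _ hs'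
  obtain ⟨hx, hy, hz, hw, hq', hp⟩ := hsol _ hs'
  have reflect : ∀ {f : ℝ → ℂ} {d : ℂ}, HasDerivAt f d (-s) →
      HasDerivAt (fun u => f (-u)) (-d) s := fun {f d} hf => by
    simpa [Function.comp_def] using HasDerivAt.scomp s hf (hasDerivAt_neg s)
  have hid : HasDerivAt (fun u : ℝ => -(u : ℂ)) (-1) s :=
    (HasDerivAt.ofReal_comp (hasDerivAt_id s)).neg
  refine ⟨(reflect hx).congr_deriv ?_, (reflect hy).congr_deriv ?_,
    (reflect hz).congr_deriv ?_, (reflect hw).congr_deriv ?_,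
    (reflect hq').congr_deriv ?_,
    (((reflect hp).sub ((hasDerivAt_const s (2 * a5)).div (reflect hq') hqs)).add
      (hid.div ((reflect hq').pow 2) (pow_ne_zero 2 hqs))).congr_deriv ?_⟩
  all_goals
    push_cast [Pi.pow_apply]
    field_simp
  all_goals ring
end

section
/- Let (x,y,z,w,q,p) : I → ℂ⁶ be a differentiable solution of the system of type D5^(1) with parameters (α0,α1,α2,α3,α4,α5) on an interval I with 0 ∉ I, and assume q(t) ≠ 0 for all t ∈ I. Define the new parameters A0 = α0, A1 = α1, A2 = α2, A3 = α3, A4 = α4, A5 = (α5−α4)/2 and the new functions X = x, Y = y, Z = z, W = w, Q = 1/q, P = −(pq + α4)q. Then A0 + A1 + 2A2 + 2A3 + 2A4 + 2A5 = 1 and (X,Y,Z,W,Q,P) is a solution of the second system of type B5^(1) with parameters (A0,A1,A2,A3,A4,A5). -/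
/-- Theorem 3.6: if `(x,y,z,w,q,p)` solves the `D5^(1)` system with parameters
`(α0,…,α5)` on `I` with `q ≠ 0`, then with the new parameters
`A0 = α0, A1 = α1, A2 = α2, A3 = α3, A4 = α4, A5 = (α5−α4)/2` one has
`A0 + A1 + 2A2 + 2A3 + 2A4 + 2A5 = 1`, and
`(X,Y,Z,W,Q,P) = (x, y, z, w, 1/q, −(pq+α4)q)` solves the second `B5^(1)`
system with parameters `(A0,…,A5)`. -/
theorem D5_to_B5b (a0 a1 a2 a3 a4 a5 : ℂ)
    (hpar : a0 + a1 + 2 * a2 + 2 * a3 + a4 + a5 = 1)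
    (I : Set ℝ) (hI : (0 : ℝ) ∉ I) (x y z w q p : ℝ → ℂ)
    (hsol : IsSolD5 a0 a1 a2 a3 a4 a5 I x y z w q p)
    (hq : ∀ t ∈ I, q t ≠ 0) :
    a0 + a1 + 2 * a2 + 2 * a3 + 2 * a4 + 2 * ((a5 - a4) / 2) = 1 ∧
    IsSolB5b a0 a1 a2 a3 a4 ((a5 - a4) / 2) I
      x y z w (fun t => 1 / q t) (fun t => -(p t * q t + a4) * q t) := by
  refine ⟨by linear_combination hpar, fun t ht => ?_⟩
  obtain ⟨hx, hy, hz, hw, hq', hp⟩ := hsol t ht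
  have hqt : q t ≠ 0 := hq t ht
  have ht0 : (t : ℂ) ≠ 0 := by
    rintro h
    exact hI (Complex.ofReal_eq_zero.mp h ▸ ht)
  refine ⟨hx, hy.congr_deriv ?_, hz.congr_deriv ?_, hw.congr_deriv ?_,
    ((hasDerivAt_const t (1 : ℂ)).fun_div hq' hqt).congr_deriv ?_,
    ((((hp.fun_mul hq').add_const a4).fun_neg).fun_mul hq').congr_deriv ?_⟩ <;>
  · field_simp
    ring
end

section
/- Let (x,y,z,w,q,p) : I → ℂ⁶ be a differentiable solution of the first system of type B5^(1) with parameters (α0,α1,α2,α3,α4,α5) on an interval I with 0 ∉ I, and assume y(t) ≠ 0 and q(t) ≠ 0 for all t ∈ I. Define the new parameters A0 = α1, A1 = 2α0 + α1, A2 = α2, A3 = α3, A4 = α4, A5 = (α5−α4)/2 and the new functions X = −(xy − α1)y, Y = 1/y, Z = z, W = w, Q = 1/q, P = −(pq + α4)q. Then A0 + A1 + 2A2 + 2A3 + 2A4 + 2A5 = 1 and (X,Y,Z,W,Q,P) is a solution of the second system of type B5^(1) with parameters (A0,A1,A2,A3,A4,A5). -/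
/-- Theorem 3.7: if `(x,y,z,w,q,p)` solves the first `B5^(1)` system with
parameters `(α0,…,α5)` on `I` with `y ≠ 0` and `q ≠ 0`, then with the new
parameters `A0 = α1, A1 = 2α0+α1, A2 = α2, A3 = α3, A4 = α4, A5 = (α5−α4)/2`
one has `A0 + A1 + 2A2 + 2A3 + 2A4 + 2A5 = 1`, and
`(X,Y,Z,W,Q,P) = (−(xy−α1)y, 1/y, z, w, 1/q, −(pq+α4)q)` solves the second
`B5^(1)` system with parameters `(A0,…,A5)`. -/
theorem B5a_to_B5b (a0 a1 a2 a3 a4 a5 : ℂ)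
    (hpar : 2 * a0 + 2 * a1 + 2 * a2 + 2 * a3 + a4 + a5 = 1)
    (I : Set ℝ) (hI : (0 : ℝ) ∉ I) (x y z w q p : ℝ → ℂ)
    (hsol : IsSolB5a a0 a1 a2 a3 a4 a5 I x y z w q p)
    (hy : ∀ t ∈ I, y t ≠ 0) (hq : ∀ t ∈ I, q t ≠ 0) :
    a1 + (2 * a0 + a1) + 2 * a2 + 2 * a3 + 2 * a4 + 2 * ((a5 - a4) / 2) = 1 ∧
    IsSolB5b a1 (2 * a0 + a1) a2 a3 a4 ((a5 - a4) / 2) I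
      (fun t => -(x t * y t - a1) * y t) (fun t => 1 / y t) z w
      (fun t => 1 / q t) (fun t => -(p t * q t + a4) * q t) := by
  refine ⟨by linear_combination hpar, fun t ht => ?_⟩
  obtain ⟨hx', hy', hz', hw', hq', hp'⟩ := hsol t ht
  have hyt := hy t ht
  have hqt := hq t ht
  have ht0 : (t : ℂ) ≠ 0 := Complex.ofReal_ne_zero.mpr fun h => hI (h ▸ ht)
  obtain rfl : a5 = 1 - 2 * a0 - 2 * a1 - 2 * a2 - 2 * a3 - a4 := by
    linear_combination hpar
  beta_reduce
  simp only [one_div]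
  refine ⟨?_, ?_, ?_, ?_, ?_, ?_⟩
  · refine (((hx'.fun_mul hy').sub_const a1).fun_neg.fun_mul hy').congr_deriv ?_
    field_simp
    ring
  · refine (hy'.fun_inv hyt).congr_deriv ?_
    field_simp
    ring
  · refine hz'.congr_deriv ?_
    field_simp
    ring
  · refine hw'.congr_deriv ?_
    field_simp
    ring
  · refine (hq'.fun_inv hqt).congr_deriv ?_
    field_simp
    ring
  · refine (((hp'.fun_mul hq').add_const a4).fun_neg.fun_mul hq').congr_deriv ?_
    field_simp
    ring
end

section
/- Let (x,y,z,w,q,p) : I → ℂ⁶ be a differentiable solution of the system of type D6^(2) with parameters (α0,α1,α2,α3,α4,α5) on an interval I with 0 ∉ I. Define on the reflected interval −I the functions X(s) = −(−s)·p(−s), Y(s) = q(−s)/(−s), Z(s) = (−s)·w(−s), W(s) = −z(−s)/(−s), Q(s) = −(−s)·y(−s), P(s) = x(−s)/(−s). Then (X,Y,Z,W,Q,P) is a solution of the system of type D6^(2) on −I with the reversed parameters (α5, α4, α3, α2, α1, α0). -/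
/-- A solution of the system of type `D6^(2)` (equation (17) of the paper)
with parameters `(a0,…,a5)` on a set `I ⊆ ℝ`. -/
def IsSolD62 (a0 a1 a2 a3 a4 a5 : ℂ) (I : Set ℝ) (x y z w q p : ℝ → ℂ) : Prop :=
  ∀ t ∈ I,
    HasDerivAt x ((2 * x t ^ 2 * y t + 2 * a0 * x t) / t -
      2 * (2 * x t * y t * z t - a1 * z t) / t) t ∧
    HasDerivAt y (-(2 * x t * y t ^ 2 + 2 * a0 * y t - 1) / t + 2 * y t ^ 2 * z t / t) t ∧
    HasDerivAt z ((2 * z t ^ 2 * w t + 2 * (a0 + a1 + a2) * z t + t) / t +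
      2 * q t * (q t * p t + a4) / t) t ∧
    HasDerivAt w (-(2 * z t * w t ^ 2 + 2 * (a0 + a1 + a2) * w t + 1) / t +
      2 * y t * (x t * y t - a1) / t) t ∧
    HasDerivAt q ((2 * q t ^ 2 * p t - (2 * a5 - 1) * q t + t) / t + 2 * w t * q t ^ 2 / t) t ∧
    HasDerivAt p ((-2 * q t * p t ^ 2 + (2 * a5 - 1) * p t) / t -
      2 * (2 * w t * q t * p t + a4 * w t) / t) t

/-- Derivative of a product with the reflected variable. -/
theorem hasDerivAt_neg_mul_comp_neg {f : ℝ → ℂ} {f' : ℂ} {s : ℝ}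
    (hf : HasDerivAt f f' (-s)) :
    HasDerivAt (fun u : ℝ => -(u : ℂ) * f (-u)) (-f (-s) + s * f') s := by
  have hid : HasDerivAt (fun u : ℝ => (u : ℂ)) 1 s := Complex.ofRealCLM.hasDerivAt
  have hcomp : HasDerivAt (fun u : ℝ => f (-u)) (-f') s :=
    (hf.scomp s (hasDerivAt_neg s)).congr_deriv (by simp)
  exact (hid.fun_neg.fun_mul hcomp).congr_deriv (by ring)

/-- Derivative of a quotient by the reflected variable. -/
theorem hasDerivAt_comp_neg_div_neg {f : ℝ → ℂ} {f' : ℂ} {s : ℝ} (hs : s ≠ 0)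
    (hf : HasDerivAt f f' (-s)) :
    HasDerivAt (fun u : ℝ => f (-u) / (-(u : ℂ))) ((s * f' + f (-s)) / (s : ℂ) ^ 2) s := by
  have hid : HasDerivAt (fun u : ℝ => (u : ℂ)) 1 s := Complex.ofRealCLM.hasDerivAt
  have hcomp : HasDerivAt (fun u : ℝ => f (-u)) (-f') s :=
    (hf.scomp s (hasDerivAt_neg s)).congr_deriv (by simp)
  have hs' : (s : ℂ) ≠ 0 := Complex.ofReal_ne_zero.mpr hs
  exact (hcomp.fun_div hid.fun_neg (neg_ne_zero.mpr hs')).congr_deriv (by ring)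

/-- Theorem 4.1, diagram reversal `ψ`: if `(x,y,z,w,q,p)` solves the `D6^(2)`
system with parameters `(α0,…,α5)` on `I` (with `0 ∉ I`), then the functions
`X(s) = −(−s)p(−s)`, `Y(s) = q(−s)/(−s)`, `Z(s) = (−s)w(−s)`,
`W(s) = −z(−s)/(−s)`, `Q(s) = −(−s)y(−s)`, `P(s) = x(−s)/(−s)` solve the
`D6^(2)` system on `−I` with the reversed parameters `(α5,α4,α3,α2,α1,α0)`. -/
theorem D62_backlund_psi (a0 a1 a2 a3 a4 a5 : ℂ)
    (hpar : a0 + a1 + a2 + a3 + a4 + a5 = 1 / 2)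
    (I : Set ℝ) (hI : (0 : ℝ) ∉ I) (x y z w q p : ℝ → ℂ)
    (hsol : IsSolD62 a0 a1 a2 a3 a4 a5 I x y z w q p) :
    IsSolD62 a5 a4 a3 a2 a1 a0 (-I)
      (fun s => -(-(s : ℂ)) * p (-s))
      (fun s => q (-s) / (-(s : ℂ)))
      (fun s => (-(s : ℂ)) * w (-s))
      (fun s => -z (-s) / (-(s : ℂ)))
      (fun s => -(-(s : ℂ)) * y (-s))
      (fun s => x (-s) / (-(s : ℂ))) := by
  intro s hs
  have hs0 : s ≠ 0 := by
    rintro rfl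
    exact hI (by simpa using hs)
  have hsc : (s : ℂ) ≠ 0 := Complex.ofReal_ne_zero.mpr hs0
  have ha : a5 + a4 + a3 = 1 / 2 - (a0 + a1 + a2) := by linear_combination hpar
  obtain ⟨hx, hy, hz, hw, hq, hp⟩ := hsol (-s) (Set.mem_neg.mp hs)
  rw [ha]
  push_cast at hx hy hz hw hq hp
  refine ⟨?_, ?_, ?_, ?_, ?_, ?_⟩
  · have h := (hasDerivAt_neg_mul_comp_neg hp).fun_neg
    simp only [← neg_mul] at h
    exact h.congr_deriv (by field_simp; ring)
  · exact (hasDerivAt_comp_neg_div_neg hs0 hq).congr_deriv (by field_simp; ring)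
  · exact (hasDerivAt_neg_mul_comp_neg hw).congr_deriv (by field_simp; ring)
  · exact (hasDerivAt_comp_neg_div_neg hs0 hz.fun_neg).congr_deriv (by field_simp; ring)
  · have h := (hasDerivAt_neg_mul_comp_neg hy).fun_neg
    simp only [← neg_mul] at h
    exact h.congr_deriv (by field_simp; ring)
  · exact (hasDerivAt_comp_neg_div_neg hs0 hx).congr_deriv (by field_simp; ring)
end

section
/- Let (x,y,z,w,q,p) : I → ℂ⁶ be a differentiable solution of the system of type D5^(1) with parameters (α0,α1,α2,α3,α4,α5) on an interval I with 0 ∉ I, and assume y(t) ≠ 0 and q(t) ≠ 0 for all t ∈ I. Define the new parameters A0 = (α1−α0)/2, A1 = α0, A2 = α2, A3 = α3, A4 = α4, A5 = (α5−α4)/2 and the new functions X = −(xy − α0)y, Y = 1/y, Z = z, W = w, Q = 1/q, P = −(pq + α4)q. Then A0 + A1 + A2 + A3 + A4 + A5 = 1/2 and (X,Y,Z,W,Q,P) is a solution of the system of type D6^(2) with parameters (A0,A1,A2,A3,A4,A5). -/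
/-- Theorem 4.3: if `(x,y,z,w,q,p)` solves the `D5^(1)` system with parameters
`(α0,…,α5)` on `I` with `y ≠ 0` and `q ≠ 0`, then with the new parameters
`A0 = (α1−α0)/2, A1 = α0, A2 = α2, A3 = α3, A4 = α4, A5 = (α5−α4)/2` one has
`A0 + A1 + A2 + A3 + A4 + A5 = 1/2`, and
`(X,Y,Z,W,Q,P) = (−(xy−α0)y, 1/y, z, w, 1/q, −(pq+α4)q)` solves the `D6^(2)`
system with parameters `(A0,…,A5)`. -/
theorem D5_to_D62 (a0 a1 a2 a3 a4 a5 : ℂ)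
    (hpar : a0 + a1 + 2 * a2 + 2 * a3 + a4 + a5 = 1)
    (I : Set ℝ) (hI : (0 : ℝ) ∉ I) (x y z w q p : ℝ → ℂ)
    (hsol : IsSolD5 a0 a1 a2 a3 a4 a5 I x y z w q p)
    (hy : ∀ t ∈ I, y t ≠ 0) (hq : ∀ t ∈ I, q t ≠ 0) :
    (a1 - a0) / 2 + a0 + a2 + a3 + a4 + (a5 - a4) / 2 = 1 / 2 ∧
    IsSolD62 ((a1 - a0) / 2) a0 a2 a3 a4 ((a5 - a4) / 2) I
      (fun t => -(x t * y t - a0) * y t) (fun t => 1 / y t) z w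
      (fun t => 1 / q t) (fun t => -(p t * q t + a4) * q t) := by
  refine ⟨by linear_combination hpar / 2, fun t ht => ?_⟩
  obtain ⟨hx', hy', hz', hw', hq', hp'⟩ := hsol t ht
  have hyt := hy t ht
  have hqt := hq t ht
  have ht0 : (t : ℂ) ≠ 0 := by
    rintro h
    exact hI (Complex.ofReal_eq_zero.mp h ▸ ht)
  refine ⟨?_, ?_, ?_, ?_, ?_, ?_⟩
  · refine ((hx'.mul hy').sub_const a0).neg.mul hy' |>.congr_deriv ?_
    simp only [Pi.mul_apply, Pi.neg_apply]
    field_simp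
    ring
  · simp only [one_div]
    refine (hy'.fun_inv hyt).congr_deriv ?_
    field_simp
    ring
  · refine hz'.congr_deriv ?_
    field_simp
    ring
  · refine hw'.congr_deriv ?_
    field_simp
    ring
  · simp only [one_div]
    refine (hq'.fun_inv hqt).congr_deriv ?_
    field_simp
    ring
  · refine ((hp'.mul hq').add_const a4).neg.mul hq' |>.congr_deriv ?_
    simp only [Pi.mul_apply, Pi.neg_apply]
    field_simp
    ring
end
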